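/- Let n ≥ 2 and let x be an invertible totally nonnegative n×n real matrix. Then x is oscillatory if and only if x does not belong to any proper parabolic subgroup of GL_n containing the upper- or lower-triangular matrices; concretely, if and only if for every i ∈ {1, …, n−1} there exist indices k ≤ i < l with x_{k,l} ≠ 0 and indices k′ ≤ i < l′ with x_{l′,k′} ≠ 0 (i.e., for no i is x block-lower-triangular or block-upper-triangular with respect to the partition of {1, …, n} into {1, …, i} and {i+1, …, n}). -/

import Mathlib

/-- A square real matrix is totally nonnegative if every minor (determinant of a
square submatrix selected by strictly increasing row and column indices) is nonnegative. -/
def TotallyNonneg {n : ℕ} (x : Matrix (Fin n) (Fin n) ℝ) : Prop :=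
  ∀ (k : ℕ) (f g : Fin k → Fin n), StrictMono f → StrictMono g →
    0 ≤ (x.submatrix f g).det

/-- A square real matrix is totally positive if every minor is positive. -/
def TotallyPos {n : ℕ} (x : Matrix (Fin n) (Fin n) ℝ) : Prop :=
  ∀ (k : ℕ) (f g : Fin k → Fin n), StrictMono f → StrictMono g →
    0 < (x.submatrix f g).det

/-- A matrix is oscillatory if some positive integer power of it is totally positive. -/
def Oscillatory {n : ℕ} (x : Matrix (Fin n) (Fin n) ℝ) : Prop :=
  ∃ m : ℕ, 0 < m ∧ TotallyPos (x ^ m)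

open Finset in
/-- The Cauchy–Binet formula. -/
theorem Matrix.det_mul_eq_sum_orderEmbedding {R ι : Type*} [CommRing R] [Fintype ι]
    [LinearOrder ι] {k : ℕ} (M : Matrix (Fin k) ι R) (N : Matrix ι (Fin k) R) :
    (M * N).det =
      ∑ h : Fin k ↪o ι, (M.submatrix id h).det * (N.submatrix h id).det := by
  have expand : (M * N).det =
      ∑ p : Fin k → ι, (∏ i, N (p i) i) * (M.submatrix id p).det := by
    simp only [det_apply', mul_apply, prod_univ_sum, mul_sum, Fintype.piFinset_univ,
      submatrix_apply, id, prod_mul_distrib]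
    rw [Finset.sum_comm]
    exact sum_congr rfl fun _ _ => sum_congr rfl fun _ _ => by ring
  have det_zero (p : Fin k → ι) (hp : ¬ Function.Injective p) :
      (M.submatrix id p).det = 0 := by
    simp only [Function.Injective, not_forall] at hp
    obtain ⟨i, j, hij, hne⟩ := hp
    exact det_zero_of_column_eq hne fun l => by simp [hij]
  have regroup : ∑ p : Fin k → ι, (∏ i, N (p i) i) * (M.submatrix id p).det =
      ∑ q : (Fin k ↪o ι) × Equiv.Perm (Fin k),
        (∏ i, N (q.1 (q.2 i)) i) * (M.submatrix id (q.1 ∘ q.2)).det := by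
    symm
    refine sum_of_injOn (fun q => q.1 ∘ q.2) ?_ (by simp) ?_ (by simp)
    · rintro ⟨h, σ⟩ - ⟨h', σ'⟩ - heq
      simp only at heq
      have hh : h = h' := by
        have : Set.range h = Set.range h' := by
          rw [← σ.surjective.range_comp h, heq, σ'.surjective.range_comp]
        exact DFunLike.coe_injective ((h.strictMono.range_inj h'.strictMono).1 this)
      subst hh
      refine Prod.ext rfl (Equiv.ext fun i => h.injective (congrFun heq i))
    · intro p _ hp
      rw [det_zero p, mul_zero]
      intro hinj
      refine hp ⟨⟨OrderEmbedding.ofStrictMono _ ((Tuple.monotone_sort p).strictMono_of_injective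
        (hinj.comp (Tuple.sort p).injective)), (Tuple.sort p)⁻¹⟩, by simp, ?_⟩
      ext i
      simp
  rw [expand, regroup, Fintype.sum_prod_type]
  refine sum_congr rfl fun h _ => ?_
  have perm_col (σ : Equiv.Perm (Fin k)) : (M.submatrix id (h ∘ σ)).det =
      Equiv.Perm.sign σ * (M.submatrix id h).det := by
    rw [← det_permute' σ (M.submatrix id h), submatrix_submatrix]
    rfl
  simp only [perm_col]
  rw [det_apply' (N.submatrix h id), mul_sum]
  exact sum_congr rfl fun σ _ => by simp only [submatrix_apply, id]; ring

namespace TotallyNonneg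

variable {n : ℕ}

theorem submatrix {x : Matrix (Fin n) (Fin n) ℝ} (hx : TotallyNonneg x) {m : ℕ}
    {f g : Fin m → Fin n} (hf : StrictMono f) (hg : StrictMono g) :
    TotallyNonneg (x.submatrix f g) :=
  fun k f' g' hf' hg' => hx k (f ∘ f') (g ∘ g') (hf.comp hf') (hg.comp hg')

theorem transpose {x : Matrix (Fin n) (Fin n) ℝ} (hx : TotallyNonneg x) :
    TotallyNonneg x.transpose := fun k f g hf hg => by
  rw [← Matrix.transpose_submatrix, Matrix.det_transpose]
  exact hx k g f hg hf

theorem rev {x : Matrix (Fin n) (Fin n) ℝ} (hx : TotallyNonneg x) :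
    TotallyNonneg (x.submatrix Fin.rev Fin.rev) := fun k f g hf hg => by
  have key := hx k (Fin.rev ∘ f ∘ Fin.rev) (Fin.rev ∘ g ∘ Fin.rev)
    (fun _ _ h => Fin.rev_lt_rev.2 (hf (Fin.rev_lt_rev.2 h)))
    (fun _ _ h => Fin.rev_lt_rev.2 (hg (Fin.rev_lt_rev.2 h)))
  rwa [← Matrix.det_submatrix_equiv_self Fin.revPerm, Matrix.submatrix_submatrix,
    Matrix.submatrix_submatrix]

theorem apply_nonneg {x : Matrix (Fin n) (Fin n) ℝ} (hx : TotallyNonneg x) (i j : Fin n) :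
    0 ≤ x i j := by
  simpa using hx 1 (fun _ => i) (fun _ => j) (Subsingleton.strictMono _) (Subsingleton.strictMono _)

theorem apply_mul_apply_le {x : Matrix (Fin n) (Fin n) ℝ} (hx : TotallyNonneg x) {i i' j j' : Fin n}
    (hi : i < i') (hj : j < j') : x i j' * x i' j ≤ x i j * x i' j' := by
  have := hx 2 ![i, i'] ![j, j'] (by simpa [Fin.strictMono_iff_lt_succ])
    (by simpa [Fin.strictMono_iff_lt_succ])
  rw [Matrix.det_fin_two] at this
  simpa using this

end TotallyNonneg

/-- The Schur complement of the top left entry. -/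
noncomputable def Matrix.schurZero {n : ℕ} (y : Matrix (Fin (n + 1)) (Fin (n + 1)) ℝ) :
    Matrix (Fin n) (Fin n) ℝ :=
  Matrix.of fun i j => y i.succ j.succ - y i.succ 0 / y 0 0 * y 0 j.succ

theorem Matrix.det_eq_mul_det_schurZero {n : ℕ} {y : Matrix (Fin (n + 1)) (Fin (n + 1)) ℝ}
    (h : y 0 0 ≠ 0) : y.det = y 0 0 * y.schurZero.det := by
  let B : Matrix (Fin (n + 1)) (Fin (n + 1)) ℝ :=
    Matrix.of fun i j => y i j - (if i = 0 then 0 else y i 0 / y 0 0) * y 0 j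
  have hB : y.det = B.det := by
    refine det_eq_of_forall_row_eq_smul_add_const (fun i => if i = 0 then 0 else y i 0 / y 0 0)
      0 (by simp) fun i j => ?_
    simp [B]
  rw [hB, det_succ_column_zero, Fin.sum_univ_succ]
  have hz (i : Fin n) : B i.succ 0 = 0 := by simp [B, Fin.succ_ne_zero, h]
  have hsub : B.submatrix Fin.succ Fin.succ = y.schurZero := by
    ext i j
    simp [B, schurZero, Fin.succ_ne_zero]
  simp [hz, hsub, Fin.succAbove_zero]
  simp [B]

/-- Prepend the index `0`. -/
def Fin.consZero {k n : ℕ} (f : Fin k → Fin n) : Fin (k + 1) → Fin (n + 1) :=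
  Fin.cons 0 (Fin.succ ∘ f)

theorem Fin.consZero_strictMono {k n : ℕ} {f : Fin k → Fin n} (hf : StrictMono f) :
    StrictMono (Fin.consZero f) := by
  intro i j hij
  cases j using Fin.cases with
  | zero => exact absurd hij (Fin.not_lt_zero i)
  | succ j =>
    cases i using Fin.cases with
    | zero => simp [consZero]
    | succ i => simpa [consZero] using hf (Fin.succ_lt_succ_iff.1 hij)

theorem Matrix.schurZero_submatrix {k n : ℕ} (y : Matrix (Fin (n + 1)) (Fin (n + 1)) ℝ)
    (f g : Fin k → Fin n) :
    (y.submatrix (Fin.consZero f) (Fin.consZero g)).schurZero = y.schurZero.submatrix f g := by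
  ext i j
  simp [schurZero, Fin.consZero]

theorem Fin.consZero_succAbove {n : ℕ} (i : Fin (n + 1)) :
    Fin.consZero i.succAbove = i.succ.succAbove := by
  ext j
  cases j using Fin.cases <;> simp [consZero]

theorem Matrix.det_submatrix_consZero {k n : ℕ} {y : Matrix (Fin (n + 1)) (Fin (n + 1)) ℝ}
    (h : y 0 0 ≠ 0) (f g : Fin k → Fin n) :
    (y.submatrix (Fin.consZero f) (Fin.consZero g)).det =
      y 0 0 * (y.schurZero.submatrix f g).det := by
  rw [det_eq_mul_det_schurZero (by simpa [Fin.consZero] using h), schurZero_submatrix]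
  simp [Fin.consZero]

namespace TotallyNonneg

theorem apply_zero_zero_pos {n : ℕ} {y : Matrix (Fin (n + 1)) (Fin (n + 1)) ℝ}
    (hy : TotallyNonneg y) (hdet : y.det ≠ 0) : 0 < y 0 0 := by
  refine (hy.apply_nonneg 0 0).lt_of_ne' fun h0 => ?_
  have hex : ∃ i, y i 0 ≠ 0 := by
    by_contra! hc
    exact hdet (Matrix.det_eq_zero_of_column_eq_zero 0 hc)
  obtain ⟨i, hi⟩ := hex
  have hi0 : 0 < i := Fin.pos_of_ne_zero fun h => hi (h ▸ h0)
  refine hdet (Matrix.det_eq_zero_of_row_eq_zero 0 fun j => ?_)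
  rcases Fin.eq_zero_or_eq_succ j with rfl | ⟨j, rfl⟩
  · exact h0
  have := hy.apply_mul_apply_le hi0 (Fin.succ_pos j)
  rw [h0, zero_mul] at this
  have hpos := (hy.apply_nonneg i 0).lt_of_ne' hi
  exact le_antisymm (nonpos_of_mul_nonpos_left this hpos) (hy.apply_nonneg _ _)

theorem schurZero {n : ℕ} {y : Matrix (Fin (n + 1)) (Fin (n + 1)) ℝ}
    (hy : TotallyNonneg y) (h : 0 < y 0 0) : TotallyNonneg y.schurZero := fun k f g hf hg => by
  have := hy _ _ _ (Fin.consZero_strictMono hf) (Fin.consZero_strictMono hg)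
  rw [Matrix.det_submatrix_consZero h.ne'] at this
  exact nonneg_of_mul_nonneg_right this h

theorem det_nonneg {n : ℕ} {y : Matrix (Fin n) (Fin n) ℝ} (hy : TotallyNonneg y) :
    0 ≤ y.det := hy n id id strictMono_id strictMono_id

theorem det_rev {n : ℕ} (y : Matrix (Fin n) (Fin n) ℝ) :
    (y.submatrix Fin.rev Fin.rev).det = y.det :=
  Matrix.det_submatrix_equiv_self Fin.revPerm y

theorem det_succAbove_pos {n : ℕ} {y : Matrix (Fin (n + 1)) (Fin (n + 1)) ℝ}
    (hy : TotallyNonneg y) (hdet : y.det ≠ 0) (i : Fin (n + 1)) :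
    0 < (y.submatrix i.succAbove i.succAbove).det := by
  induction n with
  | zero => simp
  | succ n ih =>
    have step {z : Matrix (Fin (n + 2)) (Fin (n + 2)) ℝ} (hz : TotallyNonneg z)
        (hdet : z.det ≠ 0) (i : Fin (n + 1)) :
        0 < (z.submatrix i.succ.succAbove i.succ.succAbove).det := by
      have h0 := hz.apply_zero_zero_pos hdet
      rw [← Fin.consZero_succAbove, Matrix.det_submatrix_consZero h0.ne']
      rw [Matrix.det_eq_mul_det_schurZero h0.ne'] at hdet
      exact mul_pos h0 (ih (hz.schurZero h0) (right_ne_zero_of_mul hdet) i)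
    cases i using Fin.cases with
    | succ i => exact step hy hdet i
    | zero =>
      have := step hy.rev (by rwa [det_rev]) (Fin.last n)
      rw [← det_rev]
      convert this using 2
      ext a b
      simp [Fin.rev_castSucc]

theorem det_submatrix_self_pos {n : ℕ} {y : Matrix (Fin n) (Fin n) ℝ}
    (hy : TotallyNonneg y) (hdet : y.det ≠ 0) {k : ℕ} {f : Fin k → Fin n} (hf : StrictMono f) :
    0 < (y.submatrix f f).det := by
  induction n with
  | zero =>
    obtain rfl : k = 0 := by
      rcases k with _ | k
      · rfl
      · exact (f 0).elim0
    simp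
  | succ n ih =>
    by_cases hs : Function.Surjective f
    · have hk : k = n + 1 := by
        simpa using Fintype.card_of_bijective ⟨hf.injective, hs⟩
      subst hk
      have hid : f = id := (hf.range_inj strictMono_id).1 (by simp [hs.range_eq])
      simpa [hid] using hy.det_nonneg.lt_of_ne' hdet
    · simp only [Function.Surjective, not_forall, not_exists] at hs
      obtain ⟨i, hi⟩ := hs
      choose g hg using fun a => Fin.exists_succAbove_eq (hi a)
      have hfg : f = i.succAbove ∘ g := funext fun a => (hg a).symm
      have hgm : StrictMono g := fun a b hab =>
        (Fin.strictMono_succAbove i).lt_iff_lt.1 (by simpa [hg] using hf hab)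
      have := ih (hy.submatrix (Fin.strictMono_succAbove i) (Fin.strictMono_succAbove i))
        (hy.det_succAbove_pos hdet i).ne' hgm
      rwa [Matrix.submatrix_submatrix, ← hfg] at this

theorem apply_self_pos {n : ℕ} {y : Matrix (Fin n) (Fin n) ℝ}
    (hy : TotallyNonneg y) (hdet : y.det ≠ 0) (i : Fin n) : 0 < y i i := by
  simpa using hy.det_submatrix_self_pos hdet (f := fun _ : Fin 1 => i) (Subsingleton.strictMono _)

theorem apply_mul_apply_lt {n : ℕ} {y : Matrix (Fin n) (Fin n) ℝ}
    (hy : TotallyNonneg y) (hdet : y.det ≠ 0) {i j : Fin n} (h : i < j) :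
    y i j * y j i < y i i * y j j := by
  have := hy.det_submatrix_self_pos hdet (f := ![i, j]) (by simpa [Fin.strictMono_iff_lt_succ])
  rw [Matrix.det_fin_two] at this
  simpa using this

theorem schurZero_superdiag_pos {n : ℕ} {y : Matrix (Fin (n + 2)) (Fin (n + 2)) ℝ}
    (hy : TotallyNonneg y) (hdet : y.det ≠ 0) {s : Fin n}
    (h : 0 < y s.succ.castSucc s.succ.succ) :
    0 < y.schurZero s.castSucc s.succ := by
  have h0 := hy.apply_zero_zero_pos hdet
  have h' : 0 < y s.castSucc.succ s.succ.succ := h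
  have hlt : (0 : Fin (n + 2)) < s.castSucc.succ := Fin.succ_pos _
  have hlt' : s.castSucc.succ < s.succ.succ := by simp [Fin.lt_def]
  have h1 := hy.apply_mul_apply_le hlt hlt'
  have h2 := hy.apply_mul_apply_lt hdet hlt
  have h3 := hy.apply_nonneg 0 s.castSucc.succ
  have h4 := hy.apply_nonneg s.castSucc.succ 0
  have h5 := hy.apply_nonneg 0 s.succ.succ
  simp only [Matrix.schurZero, Matrix.of_apply, sub_pos]
  rw [div_mul_eq_mul_div, div_lt_iff₀ h0]
  generalize y 0 0 = a at *
  generalize y s.castSucc.succ s.succ.succ = b at *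
  generalize y s.castSucc.succ s.castSucc.succ = c at *
  generalize y 0 s.castSucc.succ = d at *
  generalize y s.castSucc.succ 0 = e at *
  generalize y 0 s.succ.succ = u at *
  by_contra! hc
  have hu : 0 < u := h5.lt_of_ne' fun hu => by
    subst hu
    nlinarith [mul_pos h' h0]
  have k1 : b * a * (u * c) ≤ e * u * (d * b) :=
    mul_le_mul hc h1 (by nlinarith [hy.apply_nonneg 0 0]) (by positivity)
  nlinarith [mul_pos hu h', mul_lt_mul_of_pos_left h2 (mul_pos hu h')]

theorem det_adjacent_succAbove_pos {n : ℕ} {y : Matrix (Fin (n + 1)) (Fin (n + 1)) ℝ}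
    (hy : TotallyNonneg y) (hdet : y.det ≠ 0) (s : Fin n) (h : 0 < y s.castSucc s.succ) :
    0 < (y.submatrix s.succ.succAbove s.castSucc.succAbove).det := by
  induction n with
  | zero => exact s.elim0
  | succ n ih =>
    have step {z : Matrix (Fin (n + 2)) (Fin (n + 2)) ℝ} (hz : TotallyNonneg z)
        (hdet : z.det ≠ 0) (s : Fin n) (h : 0 < z s.succ.castSucc s.succ.succ) :
        0 < (z.submatrix s.succ.succ.succAbove s.succ.castSucc.succAbove).det := by
      have h0 := hz.apply_zero_zero_pos hdet
      have hs := hz.schurZero_superdiag_pos hdet h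
      rw [← Fin.succ_castSucc, ← Fin.consZero_succAbove, ← Fin.consZero_succAbove,
        Matrix.det_submatrix_consZero h0.ne']
      rw [Matrix.det_eq_mul_det_schurZero h0.ne'] at hdet
      exact mul_pos h0 (ih (hz.schurZero h0) (right_ne_zero_of_mul hdet) s hs)
    cases s using Fin.cases with
    | succ s => exact step hy hdet s h
    | zero =>
      rcases n with _ | n
      · simpa using h
      · have := step hy.rev.transpose (by rwa [Matrix.det_transpose, det_rev]) (Fin.last n)
          (by simpa [Fin.rev_succ, Fin.rev_castSucc] using h)
        rw [← det_rev, ← Matrix.det_transpose]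
        convert this using 2
        ext a b
        simp [Fin.rev_castSucc, Fin.rev_succAbove]

end TotallyNonneg

/-- `g` is obtained from `f` by increasing one value by one. -/
def IsAdjacentMove {k n : ℕ} (f g : Fin k ↪o Fin n) : Prop :=
  ∃ a, (g a : ℕ) = f a + 1 ∧ ∀ b, b ≠ a → g b = f b

theorem IsAdjacentMove.exists_insert {k n : ℕ} {f g : Fin k ↪o Fin n}
    (h : IsAdjacentMove f g) :
    ∃ (a : Fin k) (u : Fin (k + 1) → Fin n), StrictMono u ∧
      u ∘ a.succ.succAbove = f ∧ u ∘ a.castSucc.succAbove = g ∧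
      (u a.succ : ℕ) = u a.castSucc + 1 := by
  obtain ⟨a, ha, hne⟩ := h
  let u : Fin (k + 1) → Fin n := a.succ.insertNth (g a) f
  have hf : u ∘ a.succ.succAbove = f := by
    ext j
    simp [u]
  have hsucc : u a.succ = g a := by simp [u]
  have hcast : u a.castSucc = f a := by
    rw [← hf]
    simp [Fin.succAbove_succ_self]
  have hg : u ∘ a.castSucc.succAbove = g := by
    ext j
    rcases eq_or_ne j a with rfl | hj
    · simp [hsucc]
    · rw [hne j hj, ← hf]
      have : a.castSucc.succAbove j = a.succ.succAbove j := by
        rcases hj.lt_or_gt with hj | hj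
        · rw [Fin.succAbove_castSucc_of_lt _ _ hj, Fin.succAbove_succ_of_le _ _ hj.le]
        · rw [Fin.succAbove_castSucc_of_le _ _ hj.le, Fin.succAbove_succ_of_lt _ _ hj]
      simp [this]
  refine ⟨a, u, Fin.strictMono_iff_lt_succ.2 fun j => ?_, hf, hg, by rw [hsucc, hcast, ha]⟩
  have lt_of_avoid {e : Fin k ↪o Fin n} {c : Fin (k + 1)} (he : u ∘ c.succAbove = e)
      (h1 : j.castSucc ≠ c) (h2 : j.succ ≠ c) : u j.castSucc < u j.succ := by
    obtain ⟨p, hp⟩ := Fin.exists_succAbove_eq h1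
    obtain ⟨q, hq⟩ := Fin.exists_succAbove_eq h2
    have hpq : p < q := (Fin.strictMono_succAbove c).lt_iff_lt.1 (by simp [hp, hq])
    have := e.strictMono hpq
    rwa [← he, Function.comp_apply, Function.comp_apply, hp, hq] at this
  rcases lt_trichotomy j a with hj | rfl | hj
  · rw [Fin.lt_def] at hj
    exact lt_of_avoid hf (by simp [Fin.ext_iff]; omega) (by simp [Fin.ext_iff]; omega)
  · rw [Fin.lt_def, hsucc, hcast, ha]
    exact Nat.lt_succ_self _
  · rw [Fin.lt_def] at hj
    exact lt_of_avoid hg (by simp [Fin.ext_iff]; omega) (by simp [Fin.ext_iff]; omega)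

theorem exists_isAdjacentMove {k n : ℕ} (hk : k ≤ n) (f : Fin k ↪o Fin n)
    (hf : f ≠ Fin.castLEOrderEmb hk) :
    ∃ g, IsAdjacentMove g f := by
  have hex : ∃ a : ℕ, ∃ h : a < k, (f ⟨a, h⟩ : ℕ) ≠ a := by
    by_contra! hc
    exact hf (by ext a; simpa using hc a a.2)
  classical
  obtain ⟨ha, hfa⟩ := Nat.find_spec hex
  have hmin : ∀ b (hb : b < k), b < Nat.find hex → (f ⟨b, hb⟩ : ℕ) = b := fun b hb hlt => by
    simpa [hb] using Nat.find_min hex hlt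
  generalize Nat.find hex = a at *
  have hle : a ≤ f ⟨a, ha⟩ := by
    by_contra! hlt
    have := hmin _ (hlt.trans ha) hlt
    rw [← Fin.ext_iff, f.injective.eq_iff, Fin.ext_iff] at this
    exact hlt.ne this
  let g : Fin k → Fin n := Function.update f ⟨a, ha⟩ ⟨f ⟨a, ha⟩ - 1, by omega⟩
  have hg : StrictMono g := by
    intro i j hij
    have hij' := Fin.lt_def.1 (f.strictMono hij)
    simp only [g, Function.update_apply, Fin.lt_def]
    split_ifs with h1 h2 h2
    · exact absurd hij (by simp [h1, h2])
    · subst h1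
      simp only 
      omega
    · subst h2
      have hia : (i : ℕ) < a := hij
      have hfi : (f i : ℕ) = i := hmin i i.2 hia
      simp only
      omega
    · exact hij'
  refine ⟨OrderEmbedding.ofStrictMono g hg, ⟨a, ha⟩, ?_, fun b hb => ?_⟩
  · simp [g]
    omega
  · simp [g, hb]

theorem reflTransGen_isAdjacentMove {k n : ℕ} (hk : k ≤ n) (f : Fin k ↪o Fin n) :
    Relation.ReflTransGen IsAdjacentMove (Fin.castLEOrderEmb hk) f := by
  induction hs : ∑ a, (f a : ℕ) using Nat.strong_induction_on generalizing f with
  | _ s ih =>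
    by_cases hf : f = Fin.castLEOrderEmb hk
    · rw [hf]
    obtain ⟨g, hg⟩ := exists_isAdjacentMove hk f hf
    refine (ih _ ?_ g rfl).tail hg
    obtain ⟨a, ha, hne⟩ := hg
    rw [← hs]
    refine Finset.sum_lt_sum (fun b _ => ?_) ⟨a, Finset.mem_univ _, by omega⟩
    rcases eq_or_ne b a with rfl | hb
    · omega
    · rw [hne b hb]

theorem TotallyNonneg.det_submatrix_pos_of_isAdjacentMove {k n : ℕ} {x : Matrix (Fin n) (Fin n) ℝ}
    (hx : TotallyNonneg x) (hdet : x.det ≠ 0)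
    (hsup : ∀ i j : Fin n, (j : ℕ) = i + 1 → 0 < x i j) {f g : Fin k ↪o Fin n}
    (h : IsAdjacentMove f g) : 0 < (x.submatrix f g).det := by
  obtain ⟨a, u, hu, hf, hg, hval⟩ := h.exists_insert
  rw [← hf, ← hg]
  exact (hx.submatrix hu hu).det_adjacent_succAbove_pos
    (hx.det_submatrix_self_pos hdet hu).ne' a (hsup _ _ hval)

open Filter in
/-- Nonnegative matrices with positive diagonal: entries along a path are eventually positive
in the powers. -/
theorem Matrix.eventually_pow_apply_pos {ι : Type*} [Fintype ι] [DecidableEq ι]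
    {P : Matrix ι ι ℝ} (hP : ∀ i j, 0 ≤ P i j) (hdiag : ∀ i, 0 < P i i) {i j : ι}
    (h : Relation.ReflTransGen (fun i j => 0 < P i j) i j) :
    ∀ᶠ m : ℕ in atTop, 0 < (P ^ m) i j := by
  have hpow (m : ℕ) : ∀ i j, 0 ≤ (P ^ m) i j := by
    induction m with
    | zero => intro i j; rw [pow_zero, one_apply]; positivity
    | succ m ih =>
      intro i j
      rw [pow_succ, mul_apply]
      exact Finset.sum_nonneg fun l _ => mul_nonneg (ih _ _) (hP _ _)
  have hstep {m : ℕ} {i j l : ι} (h1 : 0 < (P ^ m) i j) (h2 : 0 < P j l) :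
      0 < (P ^ (m + 1)) i l := by
    rw [pow_succ, mul_apply]
    exact Finset.sum_pos' (fun l _ => mul_nonneg (hpow _ _ _) (hP _ _))
      ⟨j, Finset.mem_univ _, mul_pos h1 h2⟩
  induction h with
  | refl =>
    refine Eventually.of_forall fun m => ?_
    induction m with
    | zero => simp
    | succ m ih => exact hstep ih (hdiag i)
  | tail _ hjl ih =>
    obtain ⟨N, hN⟩ := eventually_atTop.1 ih
    refine eventually_atTop.2 ⟨N + 1, fun m hm => ?_⟩
    obtain ⟨m, rfl⟩ := Nat.exists_eq_add_of_le' (Nat.le_of_add_left_le hm)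
    exact hstep (hN m (by omega)) hjl

/-- The `k`-th compound matrix. -/
noncomputable def Matrix.compound {n : ℕ} (k : ℕ) (x : Matrix (Fin n) (Fin n) ℝ) :
    Matrix (Fin k ↪o Fin n) (Fin k ↪o Fin n) ℝ :=
  Matrix.of fun f g => (x.submatrix f g).det

theorem Matrix.compound_mul {n : ℕ} (k : ℕ) (x y : Matrix (Fin n) (Fin n) ℝ) :
    (x * y).compound k = x.compound k * y.compound k := by
  ext f g
  simp only [compound, of_apply, mul_apply]
  rw [← submatrix_mul_equiv x y f (Equiv.refl _) g, det_mul_eq_sum_orderEmbedding]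
  rfl

theorem Matrix.compound_pow_succ {n : ℕ} (k : ℕ) (x : Matrix (Fin n) (Fin n) ℝ) (m : ℕ) :
    (x ^ (m + 1)).compound k = x.compound k ^ (m + 1) := by
  induction m with
  | zero => simp
  | succ m ih => rw [pow_succ, compound_mul, ih, ← pow_succ]

theorem TotallyNonneg.eventually_compound_pow_pos {n k : ℕ} {x : Matrix (Fin n) (Fin n) ℝ}
    (hx : TotallyNonneg x) (hdet : x.det ≠ 0)
    (hsup : ∀ i j : Fin n, (j : ℕ) = i + 1 → 0 < x i j)
    (hsub : ∀ i j : Fin n, (j : ℕ) = i + 1 → 0 < x j i) (f g : Fin k ↪o Fin n) :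
    ∀ᶠ m : ℕ in Filter.atTop, 0 < (x.compound k ^ m) f g := by
  have hk : k ≤ n := by simpa using Fintype.card_le_of_injective f f.injective
  refine Matrix.eventually_pow_apply_pos (fun f g : Fin k ↪o Fin n => hx k f g f.strictMono g.strictMono)
    (fun f : Fin k ↪o Fin n => hx.det_submatrix_self_pos hdet f.strictMono) ?_
  refine Relation.ReflTransGen.trans (b := Fin.castLEOrderEmb hk) ?_ ?_
  · rw [← Relation.reflTransGen_swap]
    refine Relation.ReflTransGen.mono (fun f g h => ?_) _ _ (reflTransGen_isAdjacentMove hk f)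
    have := hx.transpose.det_submatrix_pos_of_isAdjacentMove (by rwa [Matrix.det_transpose]) hsub h
    rwa [← Matrix.transpose_submatrix, Matrix.det_transpose] at this
  · exact Relation.ReflTransGen.mono (fun _ _ h => hx.det_submatrix_pos_of_isAdjacentMove hdet hsup h) _ _
      (reflTransGen_isAdjacentMove hk g)

theorem TotallyNonneg.oscillatory {n : ℕ} {x : Matrix (Fin n) (Fin n) ℝ}
    (hx : TotallyNonneg x) (hdet : x.det ≠ 0)
    (hsup : ∀ i j : Fin n, (j : ℕ) = i + 1 → 0 < x i j)
    (hsub : ∀ i j : Fin n, (j : ℕ) = i + 1 → 0 < x j i) : Oscillatory x := by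
  have hev : ∀ᶠ m : ℕ in Filter.atTop, ∀ (k : Fin (n + 1)) (f g : Fin k ↪o Fin n),
      0 < (x.compound k ^ m) f g := by
    simp only [Filter.eventually_all]
    exact fun k f g => hx.eventually_compound_pow_pos hdet hsup hsub f g
  obtain ⟨m, hm, hpos⟩ := (hev.and (Filter.eventually_gt_atTop 0)).exists
  refine ⟨m, hpos, fun k f g hf hg => ?_⟩
  have hk : k < n + 1 := by
    simpa [Nat.lt_succ_iff] using Fintype.card_le_of_injective f hf.injective
  have := hm ⟨k, hk⟩ (OrderEmbedding.ofStrictMono f hf) (OrderEmbedding.ofStrictMono g hg)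
  obtain ⟨m, rfl⟩ := Nat.exists_eq_add_one.2 hpos
  rw [← Matrix.compound_pow_succ] at this
  exact this

theorem TotallyNonneg.superdiag_pos {n : ℕ} {x : Matrix (Fin n) (Fin n) ℝ}
    (hx : TotallyNonneg x) (hdet : x.det ≠ 0) {i j : Fin n} (hij : (j : ℕ) = i + 1)
    {k l : Fin n} (hk : k ≤ i) (hl : j ≤ l) (h : x k l ≠ 0) : 0 < x i j := by
  have hkl : 0 < x k l := (hx.apply_nonneg k l).lt_of_ne' h
  have hil : 0 < x i l := by
    rcases hk.eq_or_lt with rfl | hk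
    · exact hkl
    have := hx.apply_mul_apply_le hk (show i < l by simp only [Fin.lt_def, Fin.le_def] at *; omega)
    exact pos_of_mul_pos_right ((mul_pos hkl (hx.apply_self_pos hdet i)).trans_le this)
      (hx.apply_nonneg _ _)
  rcases hl.eq_or_lt with rfl | hl
  · exact hil
  have := hx.apply_mul_apply_le (show i < j by simp only [Fin.lt_def]; omega) hl
  exact pos_of_mul_pos_left ((mul_pos hil (hx.apply_self_pos hdet j)).trans_le this)
    (hx.apply_nonneg _ _)

theorem Oscillatory.exists_apply_ne_zero {n : ℕ} {x : Matrix (Fin n) (Fin n) ℝ}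
    (hx : Oscillatory x) {i : ℕ} (hi : 1 ≤ i) (hin : i ≤ n - 1) :
    ∃ k l : Fin n, (k : ℕ) < i ∧ i ≤ (l : ℕ) ∧ x k l ≠ 0 := by
  by_contra! hc
  obtain ⟨m, -, hm⟩ := hx
  have hzero (m : ℕ) : ∀ k l : Fin n, (k : ℕ) < i → i ≤ (l : ℕ) → (x ^ m) k l = 0 := by
    induction m with
    | zero =>
      intro k l hk hl
      rw [pow_zero, Matrix.one_apply_ne (by rintro rfl; omega)]
    | succ m ih =>
      intro k l hk hl
      rw [pow_succ, Matrix.mul_apply]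
      refine Finset.sum_eq_zero fun j _ => ?_
      rcases lt_or_ge (j : ℕ) i with hj | hj
      · rw [hc j l hj hl, mul_zero]
      · rw [ih k j hk hj, zero_mul]
  have hpos := hm 1 (fun _ => ⟨0, by omega⟩) (fun _ => ⟨n - 1, by omega⟩)
    (Subsingleton.strictMono _) (Subsingleton.strictMono _)
  simp [hzero m ⟨0, by omega⟩ ⟨n - 1, by omega⟩ hi hin] at hpos

theorem Oscillatory.transpose {n : ℕ} {x : Matrix (Fin n) (Fin n) ℝ} (hx : Oscillatory x) :
    Oscillatory x.transpose := by
  obtain ⟨m, hm, h⟩ := hx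
  refine ⟨m, hm, fun k f g hf hg => ?_⟩
  rw [← Matrix.transpose_pow, ← Matrix.transpose_submatrix, Matrix.det_transpose]
  exact h k g f hg hf

/-- An invertible totally nonnegative matrix is oscillatory iff it does not lie in
any proper parabolic subgroup containing the upper- or lower-triangular matrices:
for every cut position `i` (here `i` ranges over `1, …, n-1` in 1-indexed terms, and a
1-indexed pair `k ≤ i < l` corresponds to 0-indexed indices `k` with `k + 1 ≤ i` and `l`
with `i ≤ l`) there is a nonzero entry of `x` strictly above the cut and a nonzero entry
strictly below the cut. -/
theorem stmt6 (n : ℕ) (hn : 2 ≤ n) (x : Matrix (Fin n) (Fin n) ℝ)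
    (hx : IsUnit x) (htnn : TotallyNonneg x) :
    Oscillatory x ↔
      ∀ (i : ℕ), 1 ≤ i → i ≤ n - 1 →
        (∃ k l : Fin n, (k : ℕ) < i ∧ i ≤ (l : ℕ) ∧ x k l ≠ 0) ∧
        (∃ k l : Fin n, (k : ℕ) < i ∧ i ≤ (l : ℕ) ∧ x l k ≠ 0) := by
  have hdet : x.det ≠ 0 := (x.isUnit_iff_isUnit_det.1 hx).ne_zero
  constructor
  · intro hosc i hi hin
    exact ⟨hosc.exists_apply_ne_zero hi hin, hosc.transpose.exists_apply_ne_zero hi hin⟩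
  · intro h
    refine htnn.oscillatory hdet (fun i j hij => ?_) (fun i j hij => ?_)
    · obtain ⟨k, l, hk, hl, hkl⟩ := (h j (by omega) (by omega)).1
      exact htnn.superdiag_pos hdet hij (by rw [Fin.le_def]; omega) hl hkl
    · obtain ⟨k, l, hk, hl, hkl⟩ := (h j (by omega) (by omega)).2
      exact htnn.transpose.superdiag_pos (by rwa [Matrix.det_transpose]) hij
        (by rw [Fin.le_def]; omega) hl hkl
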